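/- arXiv:1808.09021 — 3 statements merged into one kernel-verified Lean document; each statement's English description precedes it below -/
import Mathlib

section
/- Let A be a complete regular local domain of Krull dimension 2 with finite residue field k and fraction field F, and let ℓ be a prime that is invertible in k. Let L/F be a cyclic Galois field extension of degree ℓ that is unramified over A, meaning: the integral closure B of A in L is a local ring whose maximal ideal is generated by the maximal ideal of A (i.e., m_B = m_A·B) and whose residue field is an extension of k of degree ℓ. Then every unit a ∈ Aˣ is a norm from L: there exists y ∈ L with N_{L/F}(y) = a. -/
open IsLocalRing Polynomial

theorem IsLocalRing.isPrincipalIdealRing_of_maximalIdeal_eq_span_singleton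
    {R : Type*} [CommRing R] [IsLocalRing R] [IsNoetherianRing R] {t : R}
    (ht : maximalIdeal R = Ideal.span {t}) : IsPrincipalIdealRing R := by
  refine IsPrincipalIdealRing.of_prime fun P hP => ?_
  by_cases htP : t ∈ P
  · have hPm : P = maximalIdeal R :=
      le_antisymm (le_maximalIdeal hP.ne_top)
        (ht ▸ (Ideal.span_singleton_le_iff_mem (I := P)).2 htP)
    exact ⟨t, by rw [hPm, ht]⟩
  · have hbot : P = ⊥ := by
      refine Submodule.eq_bot_of_le_smul_of_le_jacobson_bot (maximalIdeal R) P
        (IsNoetherian.noetherian P) (fun q hq => ?_) (maximalIdeal_le_jacobson ⊥)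
      obtain ⟨c, rfl⟩ := Ideal.mem_span_singleton'.1 (ht ▸ le_maximalIdeal hP.ne_top hq)
      rw [mul_comm]
      exact Submodule.smul_mem_smul (ht ▸ Ideal.mem_span_singleton_self t)
        ((hP.mem_or_mem hq).resolve_right htP)
    rw [hbot]
    infer_instance

theorem IsLocalRing.isPrincipal_of_isPrime_of_notMem
    {R : Type*} [CommRing R] [IsLocalRing R] [IsNoetherianRing R] {x y : R}
    (hxy : maximalIdeal R = Ideal.span {x, y}) (P : Ideal R) [hP : P.IsPrime] (hx : x ∉ P) :
    P.IsPrincipal := by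
  have hxm : x ∈ maximalIdeal R := hxy ▸ Ideal.subset_span (by simp)
  have : Nontrivial (R ⧸ Ideal.span {x}) :=
    Ideal.Quotient.nontrivial_iff.2 fun h =>
      (mem_maximalIdeal x).1 hxm (Ideal.span_singleton_eq_top.1 h)
  let φ := Ideal.Quotient.mk (Ideal.span {x})
  have hφ : Function.Surjective φ := Ideal.Quotient.mk_surjective
  have : IsLocalRing (R ⧸ Ideal.span {x}) := IsLocalRing.of_surjective' φ hφ
  have hφx : φ x = 0 := Ideal.Quotient.eq_zero_iff_mem.2 (Ideal.mem_span_singleton_self x)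
  have hmax : maximalIdeal (R ⧸ Ideal.span {x}) = Ideal.span {φ y} := by
    have : IsLocalHom φ := .of_surjective φ hφ
    have h : Ideal.map φ (maximalIdeal R) = maximalIdeal (R ⧸ Ideal.span {x}) := by
      rw [← ((local_hom_TFAE φ).out 0 4 :).1 this, Ideal.map_comap_of_surjective φ hφ]
    rw [← h, hxy, Ideal.map_span, Set.image_pair, hφx, Ideal.span_insert_zero]
  have := isPrincipalIdealRing_of_maximalIdeal_eq_span_singleton hmax
  obtain ⟨g, hg⟩ := IsPrincipalIdealRing.principal (P.map φ)
  rw [Ideal.submodule_span_eq] at hg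
  obtain ⟨p, hp, rfl⟩ := (Ideal.mem_map_iff_of_surjective φ hφ).1
    (hg ▸ Ideal.mem_span_singleton_self g)
  refine ⟨p, le_antisymm ?_ ((Ideal.span_singleton_le_iff_mem (I := P)).2 hp)⟩
  refine Submodule.le_of_le_smul_of_le_jacobson_bot (I := maximalIdeal R)
    (IsNoetherian.noetherian P) (maximalIdeal_le_jacobson ⊥) fun q hq => ?_
  obtain ⟨c, hc⟩ := Ideal.mem_span_singleton'.1 (hg ▸ Ideal.mem_map_of_mem φ hq)
  obtain ⟨c, rfl⟩ := hφ c
  rw [← map_mul, Ideal.Quotient.eq] at hc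
  obtain ⟨d, hd⟩ := Ideal.mem_span_singleton'.1 hc
  have hdP : d ∈ P := (hP.mem_or_mem (hd ▸ P.sub_mem (P.mul_mem_left c hp) hq)).resolve_right hx
  have hq' : q = c * p + x * (-d) := by linear_combination hd
  rw [hq']
  exact Submodule.add_mem_sup (Submodule.smul_mem _ c (Submodule.mem_span_singleton_self p))
    (Submodule.smul_mem_smul hxm (P.neg_mem hdP))

theorem IsLocalRing.uniqueFactorizationMonoid_of_maximalIdeal_eq_span_pair
    {R : Type*} [CommRing R] [IsDomain R] [IsLocalRing R] [IsNoetherianRing R] {x y : R}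
    (hxy : maximalIdeal R = Ideal.span {x, y}) (hdim : 2 ≤ ringKrullDim R) :
    UniqueFactorizationMonoid R := by
  have key (P : Ideal R) (hP : P.IsPrime) (hne : P ≠ maximalIdeal R) : P.IsPrincipal := by
    by_cases hx : x ∈ P
    · refine isPrincipal_of_isPrime_of_notMem (x := y) (y := x) (hxy.trans (by rw [Set.pair_comm])) P
        fun hy => hne (le_antisymm (le_maximalIdeal hP.ne_top) ?_)
      rw [hxy, Ideal.span_le]
      exact Set.pair_subset hx hy
    · exact isPrincipal_of_isPrime_of_notMem hxy P hx
  have key' (P : Ideal R) (hP : P.IsPrime) (hne : P ≠ maximalIdeal R) (h0 : P ≠ ⊥) :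
      ∃ p ∈ P, Prime p := by
    have := key P hP hne
    exact ⟨_, Submodule.IsPrincipal.generator_mem P,
      Submodule.IsPrincipal.prime_generator_of_isPrime P h0⟩
  obtain ⟨Q, hQ, hQne, hQ0⟩ : ∃ Q : Ideal R, Q.IsPrime ∧ Q ≠ maximalIdeal R ∧ Q ≠ ⊥ := by
    obtain ⟨l, hl⟩ := (Order.le_krullDim_iff (n := 2)).1 hdim
    have h01 : l ⟨0, by omega⟩ < l ⟨1, by omega⟩ := l.strictMono (by simp [Fin.lt_def])
    have h12 : l ⟨1, by omega⟩ < l ⟨2, by omega⟩ := l.strictMono (by simp [Fin.lt_def])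
    refine ⟨(l ⟨1, by omega⟩).asIdeal, (l _).isPrime, fun h => ?_, fun h => ?_⟩
    · exact not_lt_of_ge (le_maximalIdeal (l ⟨2, by omega⟩).isPrime.ne_top)
        (lt_of_eq_of_lt h.symm h12)
    · have h' : (l ⟨0, by omega⟩).asIdeal < (l ⟨1, by omega⟩).asIdeal := h01
      exact not_lt_bot (h ▸ h')
  refine UniqueFactorizationMonoid.iff_exists_prime_mem_of_isPrime.2 fun P h0 hP => ?_
  by_cases hne : P = maximalIdeal R
  · obtain ⟨p, hp, hpp⟩ := key' Q hQ hQne hQ0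
    exact ⟨p, hne ▸ le_maximalIdeal hQ.ne_top hp, hpp⟩
  · exact key' P hP hne h0

theorem Algebra.norm_eq_neg_one_pow_mul_coeff_zero_minpoly {K L : Type*} [Field K] [Field L]
    [Algebra K L] [FiniteDimensional K L] {x : L}
    (h : (minpoly K x).natDegree = Module.finrank K L) :
    Algebra.norm K x = (-1) ^ Module.finrank K L * (minpoly K x).coeff 0 := by
  have hmin : minpoly K x = (Algebra.lmul K L x).charpoly := by
    refine (eq_of_monic_of_dvd_of_natDegree_le (minpoly.monic (Algebra.IsIntegral.isIntegral x))
      (LinearMap.charpoly_monic _) (minpoly.dvd _ _ ?_) ?_).symm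
    · apply Algebra.lmul_injective (R := K)
      rw [← Polynomial.aeval_algHom_apply, LinearMap.aeval_self_charpoly, map_zero]
    · rw [LinearMap.charpoly_natDegree, h]
  rw [hmin, Algebra.norm_apply, LinearMap.det_eq_sign_charpoly_coeff]

theorem IsLocalRing.exists_pow_eq_of_residue_eq_one {R : Type*} [CommRing R]
    [IsLocalRing R] [IsAdicComplete (maximalIdeal R) R] {n : ℕ}
    (hn : (n : ResidueField R) ≠ 0) {u : R} (hu : residue R u = 1) :
    ∃ v : R, v ^ n = u := by
  have hn0 : n ≠ 0 := by rintro rfl; simp at hn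
  have hmem : (X ^ n - C u : R[X]).eval 1 ∈ maximalIdeal R := by
    rw [← residue_eq_zero_iff]; simp [hu]
  obtain ⟨v, hv, -⟩ := HenselianRing.is_henselian (I := maximalIdeal R) (X ^ n - C u : R[X])
    (monic_X_pow_sub_C u hn0) 1 hmem (by
      have h : IsUnit (n : R) := (residue_ne_zero_iff_isUnit _).1 (by simpa using hn)
      simpa [derivative_X_pow] using h.map (Ideal.Quotient.mk (maximalIdeal R)))
  exact ⟨v, by simpa [sub_eq_zero] using hv⟩

theorem FiniteField.exists_finrank_minpoly_and_zpowers_norm (K K' : Type*) [Field K] [Field K']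
    [Finite K'] [Algebra K K'] :
    ∃ θ : K', (minpoly K θ).natDegree = Module.finrank K K' ∧
      ∀ a : K, a ≠ 0 → ∃ i : ℕ, Algebra.norm K θ ^ i = a := by
  have : Finite K := Finite.of_injective _ (algebraMap K K').injective
  obtain ⟨θ, hθ⟩ := IsCyclic.exists_monoid_generator (α := K'ˣ)
  have hpow (z : K') (hz : z ≠ 0) : ∃ i : ℕ, (θ : K') ^ i = z := by
    obtain ⟨i, hi⟩ := Submonoid.mem_powers_iff _ _ |>.1 (hθ (Units.mk0 z hz))
    exact ⟨i, by rw [← Units.val_pow_eq_pow_val, hi, Units.val_mk0]⟩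
  refine ⟨θ, ?_, fun a ha => ?_⟩
  · refine (Field.primitive_element_iff_minpoly_natDegree_eq K (θ : K')).1 ?_
    refine eq_top_iff.2 fun z _ => ?_
    by_cases hz : z = 0
    · exact hz ▸ zero_mem _
    · obtain ⟨i, rfl⟩ := hpow z hz
      exact pow_mem (IntermediateField.mem_adjoin_simple_self K _) i
  · obtain ⟨z, rfl⟩ := FiniteField.norm_surjective K K' a
    obtain ⟨i, rfl⟩ := hpow z (by rintro rfl; simp at ha)
    exact ⟨i, (map_pow _ _ _).symm⟩

/-- The norm of an integral element whose residue generates the residue field extension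
reduces to the norm of that residue. -/
theorem IsLocalRing.exists_norm_eq_algebraMap_and_residue_eq {A F L B : Type*} [CommRing A]
    [IsDomain A] [IsLocalRing A] [IsIntegrallyClosed A] [Field F] [Algebra A F]
    [IsFractionRing A F] [Field L] [Algebra F L] [Algebra A L] [IsScalarTower A F L]
    [FiniteDimensional F L] [CommRing B] [IsLocalRing B] [Algebra A B] [Algebra B L]
    [IsScalarTower A B L] [IsLocalHom (algebraMap A B)]
    [FiniteDimensional (ResidueField A) (ResidueField B)]
    (hdeg : Module.finrank (ResidueField A) (ResidueField B) = Module.finrank F L)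
    {b : B} (hb : IsIntegral A (algebraMap B L b)) (hbinj : Function.Injective (algebraMap B L))
    (hres : (minpoly (ResidueField A) (residue B b)).natDegree =
      Module.finrank (ResidueField A) (ResidueField B)) :
    ∃ n : A, Algebra.norm F (algebraMap B L b) = algebraMap A F n ∧
      residue A n = Algebra.norm (ResidueField A) (residue B b) := by
  set β := algebraMap B L b with hβ
  have hmonic := minpoly.monic hb
  have hF : minpoly F β = (minpoly A β).map (algebraMap A F) :=
    minpoly.isIntegrallyClosed_eq_field_fractions' F hb
  have hroot : aeval b (minpoly A β) = 0 := by
    apply hbinj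
    rw [map_zero, ← Polynomial.aeval_algebraMap_apply, minpoly.aeval]
  have hroot' : aeval (residue B b) ((minpoly A β).map (residue A)) = 0 := by
    have h := congrArg (residue B) hroot
    rw [map_zero, ← ResidueField.algebraMap_eq B, ← Polynomial.aeval_algebraMap_apply] at h
    rw [← ResidueField.algebraMap_eq A, Polynomial.aeval_map_algebraMap]
    exact h
  have hle : (minpoly A β).natDegree ≤ Module.finrank F L := by
    rw [← hmonic.natDegree_map (algebraMap A F), ← hF]
    exact minpoly.natDegree_le β
  have hk : minpoly (ResidueField A) (residue B b) = (minpoly A β).map (residue A) := by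
    refine (eq_of_monic_of_dvd_of_natDegree_le
      (minpoly.monic (Algebra.IsIntegral.isIntegral _))
      (hmonic.map _) (minpoly.dvd _ _ hroot') ?_).symm
    rw [hmonic.natDegree_map, hres, hdeg]
    exact hle
  have hdegF : (minpoly F β).natDegree = Module.finrank F L := by
    rw [hF, hmonic.natDegree_map, ← hmonic.natDegree_map (residue A), ← hk, hres, hdeg]
  refine ⟨(-1) ^ Module.finrank F L * (minpoly A β).coeff 0, ?_, ?_⟩
  · rw [Algebra.norm_eq_neg_one_pow_mul_coeff_zero_minpoly hdegF, hF]
    simp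
  · rw [Algebra.norm_eq_neg_one_pow_mul_coeff_zero_minpoly hres, hk, hdeg]
    simp

/-- Let `A` be a complete regular local domain of Krull dimension 2
(Noetherian local domain, complete for the maximal-adic topology, of Krull dimension 2,
whose maximal ideal is generated by two elements) with finite residue field `k` and
fraction field `F`, and let `ℓ` be a prime invertible in `k`.  If `L/F` is a cyclic
Galois extension of degree `ℓ` which is unramified over `A` (the integral closure `B`
of `A` in `L` is local, its maximal ideal is generated by that of `A`, and its residue
field has degree `ℓ` over `k`, expressed by `|k_B| = |k|^ℓ`), then every unit of `A` is
a norm from `L`. -/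
theorem statement8
    (A : Type*) [CommRing A] [IsDomain A] [IsNoetherianRing A] [IsLocalRing A]
    [IsAdicComplete (IsLocalRing.maximalIdeal A) A]
    (hdim : ringKrullDim A = 2)
    (hreg : ∃ x y : A, IsLocalRing.maximalIdeal A = Ideal.span {x, y})
    [Finite (IsLocalRing.ResidueField A)]
    (F : Type*) [Field F] [Algebra A F] [IsFractionRing A F]
    (ℓ : ℕ) (hℓ : ℓ.Prime) (hℓk : (ℓ : IsLocalRing.ResidueField A) ≠ 0)
    (L : Type*) [Field L] [Algebra F L] [Algebra A L] [IsScalarTower A F L]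
    [IsGalois F L] (hcyc : IsCyclic (L ≃ₐ[F] L))
    (hdeg : Module.finrank F L = ℓ)
    [IsLocalRing ↥(integralClosure A L)]
    (hunram : IsLocalRing.maximalIdeal ↥(integralClosure A L) =
      Ideal.map (algebraMap A ↥(integralClosure A L)) (IsLocalRing.maximalIdeal A))
    (hres : Nat.card (IsLocalRing.ResidueField ↥(integralClosure A L)) =
      Nat.card (IsLocalRing.ResidueField A) ^ ℓ)
    (a : A) (ha : IsUnit a) :
    ∃ y : L, Algebra.norm F y = algebraMap A F a := by
  obtain ⟨x, y, hxy⟩ := hreg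
  have := uniqueFactorizationMonoid_of_maximalIdeal_eq_span_pair hxy hdim.ge
  have : FiniteDimensional F L :=
    Module.finite_of_finrank_pos (hdeg ▸ hℓ.pos)
  have : IsLocalHom (algebraMap A (integralClosure A L)) :=
    ((local_hom_TFAE _).out 0 2).2 hunram.ge
  have : Finite (ResidueField (integralClosure A L)) :=
    Nat.finite_of_card_ne_zero (hres ▸ pow_ne_zero _ Nat.card_pos.ne')
  have hfin : Module.finrank (ResidueField A) (ResidueField (integralClosure A L)) = ℓ :=
    Nat.pow_right_injective (Finite.one_lt_card (α := ResidueField A))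
      (Module.natCard_eq_pow_finrank.symm.trans hres)
  obtain ⟨θ, hθ, hpow⟩ := FiniteField.exists_finrank_minpoly_and_zpowers_norm
    (ResidueField A) (ResidueField (integralClosure A L))
  obtain ⟨b, rfl⟩ := residue_surjective θ
  obtain ⟨n, hn, hnres⟩ := exists_norm_eq_algebraMap_and_residue_eq (F := F) (L := L)
    (hfin.trans hdeg.symm) b.2 Subtype.val_injective hθ
  have hares : residue A a ≠ 0 := (residue_ne_zero_iff_isUnit a).2 ha
  obtain ⟨i, hi⟩ := hpow (residue A a) hares
  rw [← hnres, ← map_pow] at hi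
  obtain ⟨w, hw⟩ : IsUnit (n ^ i) := (residue_ne_zero_iff_isUnit _).1 (hi ▸ hares)
  obtain ⟨v, hv⟩ := exists_pow_eq_of_residue_eq_one hℓk (u := ↑w⁻¹ * a) (by
    rw [map_mul, ← hi, ← map_mul, ← hw, Units.inv_mul, map_one])
  refine ⟨algebraMap (integralClosure A L) L b ^ i * algebraMap F L (algebraMap A F v), ?_⟩
  rw [map_mul, map_pow, hn, Algebra.norm_algebraMap, hdeg, ← map_pow, ← map_pow, ← map_mul,
    hv, ← hw, Units.mul_inv_cancel_left]
end

section
/- Let A be a complete regular local domain with finite residue field k and fraction field F, let ℓ be a prime that is invertible in k, and assume F contains a primitive ℓ-th root of unity. Let Y/F be a field extension of degree ℓ that is unramified over A, meaning: the integral closure B of A in Y is a local ring whose maximal ideal is generated by the maximal ideal of A (i.e., m_B = m_A·B) and whose residue field is an extension of k of degree ℓ. Then every element c ∈ Y that is integral over A and satisfies N_{Y/F}(c) = 1 is an ℓ-th power in Y. -/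
universe u

/-- In a domain, this says that every `a / b` all of whose powers have a common denominator `s`
lies in the ring, i.e. that the ring is completely integrally closed. -/
def DvdOfAlmostDvd (R : Type*) [CommRing R] : Prop :=
  ∀ s a b : R, s ≠ 0 → (∀ n : ℕ, b ^ n ∣ s * a ^ n) → b ∣ a

lemma Prime.dvd_of_dvd_pow_mul {R : Type*} [CommRing R] [IsDomain R] {p d m : R} (hp : Prime p)
    (hd : ¬ p ∣ d) (t : ℕ) (h : d ∣ p ^ t * m) : d ∣ m := by
  induction t with
  | zero => simpa using h
  | succ t ih =>
    obtain ⟨e, he⟩ := h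
    obtain ⟨f, rfl⟩ : p ∣ e := (hp.dvd_or_dvd ⟨p ^ t * m, by rw [← he]; ring⟩).resolve_left hd
    exact ih ⟨f, mul_left_cancel₀ hp.ne_zero (by linear_combination he)⟩

lemma pow_dvd_mul_sub_pow {R : Type*} [CommRing R] {s y b : R} (r : R)
    (h : ∀ n : ℕ, b ^ n ∣ s * y ^ n) (n : ℕ) : b ^ n ∣ s * (y - b * r) ^ n := by
  rw [sub_eq_add_neg, add_pow, Finset.mul_sum]
  refine Finset.dvd_sum fun m hm ↦ ?_
  have hmn : m ≤ n := Nat.lt_succ_iff.mp (Finset.mem_range.mp hm)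
  obtain ⟨c, hc⟩ := h m
  refine ⟨c * (-r) ^ (n - m) * n.choose m, ?_⟩
  conv_rhs => rw [← Nat.add_sub_cancel' hmn, pow_add]
  rw [Nat.add_sub_cancel' hmn, ← mul_neg, mul_pow]
  linear_combination (b ^ (n - m) * (-r) ^ (n - m) * n.choose m) * hc

lemma DvdOfAlmostDvd.dvd_of_not_dvd {R : Type*} [CommRing R] [IsDomain R] [IsNoetherianRing R]
    [IsLocalRing R] {x : R} (hx : Prime x) (hQ : DvdOfAlmostDvd (R ⧸ Ideal.span {x}))
    {s a b : R} (hs : ¬ x ∣ s) (hb : ¬ x ∣ b) (h : ∀ n : ℕ, b ^ n ∣ s * a ^ n) : b ∣ a := by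
  have key (N : ℕ) : ∃ r y, a = b * r + x ^ N * y ∧ ∀ n : ℕ, b ^ n ∣ s * y ^ n := by
    induction N with
    | zero => exact ⟨0, a, by simp, h⟩
    | succ N ih =>
      obtain ⟨r, y, rfl, hy⟩ := ih
      have hdvd : Ideal.Quotient.mk (Ideal.span {x}) b ∣ Ideal.Quotient.mk (Ideal.span {x}) y :=
        hQ (Ideal.Quotient.mk _ s) _ _
          (by rwa [Ne, Ideal.Quotient.eq_zero_iff_mem, Ideal.mem_span_singleton])
          fun n ↦ by simpa using map_dvd (Ideal.Quotient.mk (Ideal.span {x})) (hy n)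
      obtain ⟨r', hr'⟩ := hdvd
      obtain ⟨r', rfl⟩ := Ideal.Quotient.mk_surjective r'
      rw [← map_mul, Ideal.Quotient.eq, Ideal.mem_span_singleton] at hr'
      obtain ⟨z, hz⟩ := hr'
      refine ⟨r + x ^ N * r', z, by linear_combination x ^ N * hz, fun n ↦ ?_⟩
      have := pow_dvd_mul_sub_pow r' hy n
      rw [hz, mul_pow, mul_left_comm] at this
      exact hx.dvd_of_dvd_pow_mul (fun h' ↦ hb (hx.dvd_of_dvd_pow h')) n this
  have hxm : x ∈ IsLocalRing.maximalIdeal R := (IsLocalRing.mem_maximalIdeal x).mpr hx.not_isUnit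
  rw [← Ideal.mem_span_singleton, ← Ideal.Quotient.eq_zero_iff_mem]
  refine (inferInstance : IsHausdorff (IsLocalRing.maximalIdeal R)
    (R ⧸ Ideal.span {b})).haus _ fun N ↦ ?_
  obtain ⟨r, y, rfl, -⟩ := key N
  rw [SModEq.zero, map_add, (Ideal.Quotient.eq_zero_iff_mem (a := b * r)).mpr
    (Ideal.mem_span_singleton.mpr (dvd_mul_right _ _)), zero_add]
  exact Submodule.smul_mem_smul (Ideal.pow_mem_pow hxm N)
    (Submodule.mem_top (x := Ideal.Quotient.mk (Ideal.span {b}) y))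

lemma DvdOfAlmostDvd.of_quotient {R : Type*} [CommRing R] [IsDomain R] [IsNoetherianRing R]
    [IsLocalRing R] {x : R} (hx : Prime x) (hQ : DvdOfAlmostDvd (R ⧸ Ideal.span {x})) :
    DvdOfAlmostDvd R := by
  intro s a b hs h
  rcases eq_or_ne a 0 with rfl | ha
  · exact dvd_zero b
  rcases eq_or_ne b 0 with rfl | hb
  · simpa [hs] using h 1
  obtain ⟨t, s, hs', rfl⟩ := WfDvdMonoid.max_power_factor hs hx.irreducible
  obtain ⟨j, a, ha', rfl⟩ := WfDvdMonoid.max_power_factor ha hx.irreducible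
  obtain ⟨k, b, hb', rfl⟩ := WfDvdMonoid.max_power_factor hb hx.irreducible
  have hkj : k ≤ j := by
    by_contra! hlt
    obtain ⟨c, hc⟩ := h (t + 1)
    have h1 : ¬ x ∣ s * a ^ (t + 1) := fun h' ↦
      (hx.dvd_or_dvd h').elim hs' fun h'' ↦ ha' (hx.dvd_of_dvd_pow h'')
    obtain ⟨e, rfl⟩ := Nat.exists_eq_add_of_lt hlt
    refine h1 ⟨x ^ (e * (t + 1)) * b ^ (t + 1) * c, mul_left_cancel₀
      (pow_ne_zero (t + j * (t + 1)) hx.ne_zero) ?_⟩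
    linear_combination hc
  obtain ⟨e, rfl⟩ := Nat.exists_eq_add_of_le hkj
  rw [pow_add, mul_assoc]
  refine mul_dvd_mul_left _ (hQ.dvd_of_not_dvd hx hs' hb' fun n ↦ ?_)
  refine hx.dvd_of_dvd_pow_mul (fun h' ↦ hb' (hx.dvd_of_dvd_pow h')) t ?_
  obtain ⟨c, hc⟩ := h n
  exact ⟨c, mul_left_cancel₀ (pow_ne_zero (k * n) hx.ne_zero) (by linear_combination hc)⟩

lemma DvdOfAlmostDvd.isIntegrallyClosed {R : Type*} [CommRing R] [IsDomain R]
    (h : DvdOfAlmostDvd R) : IsIntegrallyClosed R := by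
  rw [isIntegrallyClosed_iff (FractionRing R)]
  intro y hy
  obtain ⟨s, hs, hsy⟩ := hy.isAlmostIntegral
  obtain ⟨a, b, hb, rfl⟩ := IsFractionRing.div_surjective (A := R) y
  have hb0 : algebraMap R (FractionRing R) b ≠ 0 :=
    IsFractionRing.to_map_ne_zero_of_mem_nonZeroDivisors hb
  obtain ⟨c, rfl⟩ : b ∣ a := h s a b (nonZeroDivisors.ne_zero hs) fun n ↦ by
    obtain ⟨c, hc⟩ := hsy n
    refine ⟨c, IsFractionRing.injective R (FractionRing R) ?_⟩
    rw [Algebra.smul_def, div_pow] at hc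
    field_simp at hc
    simp only [map_mul, map_pow]
    linear_combination -hc
  exact ⟨c, by rw [map_mul]; field_simp⟩

open IsLocalRing in
lemma isDomain_of_isPrime_span_singleton {R : Type*} [CommRing R] [IsNoetherianRing R]
    [IsLocalRing R] {x : R} (hxm : x ∈ maximalIdeal R) (hx : (Ideal.span {x}).IsPrime)
    (hmin : ∀ p ∈ minimalPrimes R, x ∉ p) : IsDomain R := by
  obtain ⟨p, hp, hpx⟩ := Ideal.exists_minimalPrimes_le (I := (⊥ : Ideal R)) (J := Ideal.span {x})
    bot_le
  have hprime : p.IsPrime := hp.1.1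
  have hle : p ≤ maximalIdeal R • p := by
    intro y hy
    obtain ⟨z, rfl⟩ := Ideal.mem_span_singleton.mp (hpx hy)
    exact Submodule.smul_mem_smul hxm ((hprime.mem_or_mem hy).resolve_left (hmin p hp))
  have hbot : p = ⊥ := Submodule.eq_bot_of_le_smul_of_le_jacobson_bot _ _
    (IsNoetherian.noetherian p) hle (maximalIdeal_le_jacobson _)
  rw [hbot] at hprime
  exact IsDomain.of_bot_isPrime R

open IsLocalRing in
lemma exists_mem_maximalIdeal_notMem_sq {R : Type*} [CommRing R] [IsNoetherianRing R]
    [IsLocalRing R] (hdim : 0 < ringKrullDim R) :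
    ∃ x ∈ maximalIdeal R, x ∉ maximalIdeal R ^ 2 ∧ ∀ p ∈ minimalPrimes R, x ∉ p := by
  have hmin : maximalIdeal R ∉ minimalPrimes R := fun h ↦ by
    rw [← maximalIdeal_height_eq_ringKrullDim, Ideal.height_eq_zero_iff.mpr h] at hdim
    simp at hdim
  by_contra! hcon
  have hsub : (maximalIdeal R : Set R) ⊆
      ⋃ I ∈ insert (maximalIdeal R ^ 2) (minimalPrimes R), (I : Set R) := by
    intro x hx
    by_cases h2 : x ∈ maximalIdeal R ^ 2
    · exact Set.mem_biUnion (Set.mem_insert _ _) h2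
    · obtain ⟨p, hp, hxp⟩ := hcon x hx h2
      exact Set.mem_biUnion (Set.mem_insert_of_mem _ hp) hxp
  have hfin := (minimalPrimes.finite_of_isNoetherianRing R).insert (maximalIdeal R ^ 2)
  obtain ⟨I, hI, hle⟩ := (Ideal.subset_union_prime_finite hfin (f := id) (maximalIdeal R ^ 2)
    (maximalIdeal R ^ 2) (fun I hI hne _ ↦ (hI.resolve_left hne).1.1)).mp hsub
  rcases hI with rfl | hI
  · have hbot : maximalIdeal R = ⊥ := Submodule.eq_bot_of_le_smul_of_le_jacobson_bot
      (maximalIdeal R) _ (IsNoetherian.noetherian _) (by simpa [pow_two] using hle)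
      (maximalIdeal_le_jacobson _)
    refine hmin ?_
    rw [hbot]
    have : (⊥ : Ideal R).IsPrime := hbot ▸ (inferInstance : (maximalIdeal R).IsPrime)
    simp [minimalPrimes, Ideal.minimalPrimes_eq_subsingleton_self]
  · exact hmin ((maximalIdeal.isMaximal R).eq_of_le hI.1.1.ne_top hle ▸ hI)

open IsLocalRing in
lemma spanFinrank_maximalIdeal_quotient_lt {R : Type*} [CommRing R] [IsNoetherianRing R]
    [IsLocalRing R] {x : R} [IsLocalRing (R ⧸ Ideal.span {x})] (hxm : x ∈ maximalIdeal R)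
    (hx2 : x ∉ maximalIdeal R ^ 2) :
    (maximalIdeal (R ⧸ Ideal.span {x})).spanFinrank < (maximalIdeal R).spanFinrank := by
  classical
  obtain ⟨s, hcard, hs⟩ :=
    (IsNoetherian.noetherian (maximalIdeal R)).exists_span_finset_card_eq_spanFinrank
  obtain ⟨f, hf⟩ : ∃ f : R → R, ∑ i ∈ s, f i • i = x := by
    rw [← hs, Submodule.mem_span_finset] at hxm
    exact hxm.imp fun _ h ↦ h.2
  obtain ⟨i, his, hi⟩ : ∃ i ∈ s, f i ∉ maximalIdeal R := by
    by_contra! hcon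
    refine hx2 (hf ▸ Ideal.sum_mem _ fun i hi ↦ ?_)
    rw [pow_two]
    exact Ideal.mul_mem_mul (hcon i hi) (hs ▸ Submodule.subset_span hi)
  have hmap : (maximalIdeal R).map (Ideal.Quotient.mk (Ideal.span {x})) =
      maximalIdeal (R ⧸ Ideal.span {x}) := by
    refine eq_maximalIdeal (Ideal.map_eq_top_or_isMaximal_of_surjective _
      Ideal.Quotient.mk_surjective inferInstance |>.resolve_left fun h ↦ ?_)
    have := congrArg (Ideal.comap (Ideal.Quotient.mk (Ideal.span {x}))) h
    rw [Ideal.comap_map_of_surjective _ Ideal.Quotient.mk_surjective, ← RingHom.ker_eq_comap_bot,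
      Ideal.mk_ker, Ideal.comap_top, sup_eq_left.mpr
      ((Ideal.span_singleton_le_iff_mem _).mpr hxm)] at this
    exact (maximalIdeal.isMaximal R).ne_top this
  have hspan : maximalIdeal (R ⧸ Ideal.span {x}) =
      Submodule.span _ (((s.erase i).image (Ideal.Quotient.mk (Ideal.span {x})) : Finset _) :
        Set (R ⧸ Ideal.span {x})) := by
    rw [← hmap]
    refine le_antisymm ?_ ?_
    · rw [Ideal.map_le_iff_le_comap, ← hs, Submodule.span_le]
      intro j hj
      by_cases hji : j = i
      · subst hji
        obtain ⟨u, hu⟩ := notMem_maximalIdeal.mp hi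
        have h0 : Ideal.Quotient.mk (Ideal.span {x}) (f j * j) =
            -∑ i ∈ s.erase j, Ideal.Quotient.mk (Ideal.span {x}) (f i * i) := by
          rw [eq_neg_iff_add_eq_zero, ← map_sum, ← map_add, Finset.add_sum_erase s (fun i ↦ f i * i)
            his, Ideal.Quotient.eq_zero_iff_mem]
          exact Ideal.mem_span_singleton.mpr hf.symm.dvd
        have h1 : j = ↑u⁻¹ * (f j * j) := by rw [← hu]; simp
        rw [SetLike.mem_coe, Ideal.mem_comap]
        have h2 : Ideal.Quotient.mk (Ideal.span {x}) j =
            Ideal.Quotient.mk (Ideal.span {x}) ↑u⁻¹ *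
              Ideal.Quotient.mk (Ideal.span {x}) (f j * j) := by
          rw [← map_mul, ← h1]
        rw [h2, h0]
        refine Ideal.mul_mem_left _ _ (neg_mem (Ideal.sum_mem _ fun k hk ↦ ?_))
        rw [map_mul]
        exact Ideal.mul_mem_left _ _ (Submodule.subset_span (by
          rw [Finset.coe_image]; exact Set.mem_image_of_mem _ hk))
      · exact Submodule.subset_span (by
          rw [Finset.coe_image]
          exact Set.mem_image_of_mem _ (Finset.mem_erase.mpr ⟨hji, hj⟩))
    · rw [Submodule.span_le, Finset.coe_image]
      rintro _ ⟨j, hj, rfl⟩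
      exact Ideal.mem_map_of_mem _ (hs ▸ Submodule.subset_span (Finset.mem_of_mem_erase hj))
  calc (maximalIdeal (R ⧸ Ideal.span {x})).spanFinrank
      ≤ ((s.erase i).image (Ideal.Quotient.mk (Ideal.span {x}))).card := by
        rw [hspan]
        exact (Submodule.spanFinrank_span_le_ncard_of_finite (Finset.finite_toSet _)).trans_eq
          (Set.ncard_coe_finset _)
    _ ≤ (s.erase i).card := Finset.card_image_le
    _ < s.card := Finset.card_erase_lt_of_mem his
    _ = _ := hcard

open IsLocalRing in
lemma IsRegularLocalRing.isDomain_and_dvdOfAlmostDvd (n : ℕ) (R : Type u) [CommRing R]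
    [IsRegularLocalRing R] (hn : (maximalIdeal R).spanFinrank = n) :
    IsDomain R ∧ DvdOfAlmostDvd R := by
  induction n generalizing R with
  | zero =>
    have hfield : IsField R := isField_iff_maximalIdeal_eq.mpr
      ((Submodule.spanFinrank_eq_zero_iff_eq_bot (IsNoetherian.noetherian _)).mp hn)
    let := hfield.toField
    refine ⟨inferInstance, fun s a b hs h ↦ ?_⟩
    rcases eq_or_ne b 0 with rfl | hb
    · simpa [hs] using h 1
    · exact (isUnit_iff_ne_zero.mpr hb).dvd
  | succ n ih =>
    have hdim := IsRegularLocalRing.spanFinrank_maximalIdeal (R := R)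
    rw [hn] at hdim
    obtain ⟨x, hxm, hx2, hmin⟩ := exists_mem_maximalIdeal_notMem_sq (R := R) (by
      rw [← hdim]; exact_mod_cast n.succ_pos)
    have : Nontrivial (R ⧸ Ideal.span {x}) := Ideal.Quotient.nontrivial_iff.mpr fun h ↦
      (mem_maximalIdeal x).mp hxm (Ideal.span_singleton_eq_top.mp h)
    have : IsLocalRing (R ⧸ Ideal.span {x}) :=
      IsLocalRing.of_surjective' (Ideal.Quotient.mk _) Ideal.Quotient.mk_surjective
    have hlt := spanFinrank_maximalIdeal_quotient_lt hxm hx2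
    have hle : ringKrullDim R ≤ ringKrullDim (R ⧸ Ideal.span {x}) + 1 := by
      simpa using ringKrullDim_le_ringKrullDim_quotient_add_encard ({x} : Set R)
        (Set.singleton_subset_iff.mpr
          (Ideal.jacobson_bot (R := R) ▸ maximalIdeal_le_jacobson ⊥ hxm))
    have hub := ringKrullDim_le_spanFinrank_maximalIdeal (R ⧸ Ideal.span {x})
    have hn' : (maximalIdeal (R ⧸ Ideal.span {x})).spanFinrank = n := by
      refine le_antisymm (by lia) ?_
      have h : ((n + 1 : ℕ) : WithBot ℕ∞) ≤
          (((maximalIdeal (R ⧸ Ideal.span {x})).spanFinrank + 1 : ℕ) : WithBot ℕ∞) := by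
        rw [hdim]
        refine hle.trans ?_
        push_cast
        gcongr
      exact_mod_cast Nat.le_of_succ_le_succ (by exact_mod_cast h)
    have hreg : IsRegularLocalRing (R ⧸ Ideal.span {x}) := by
      refine .of_spanFinrank_maximalIdeal_le _ ?_
      rw [hn']
      rw [← hdim] at hle
      push_cast at hle
      exact ENat.WithBot.add_le_add_one_right_iff.mp hle
    obtain ⟨hdom, hQ⟩ := ih (R ⧸ Ideal.span {x}) hn'
    have hprime : (Ideal.span {x}).IsPrime := (Ideal.Quotient.isDomain_iff_prime _).mp hdom
    have := isDomain_of_isPrime_span_singleton hxm hprime hmin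
    have hx0 : x ≠ 0 := fun h ↦ hx2 (h ▸ zero_mem _)
    exact ⟨this, hQ.of_quotient ((Ideal.span_singleton_prime hx0).mp hprime)⟩

open TensorProduct in
lemma IsAdicComplete.of_moduleFinite {R : Type*} [CommRing R] [IsNoetherianRing R] [IsLocalRing R]
    [IsAdicComplete (IsLocalRing.maximalIdeal R) R] (M : Type*) [AddCommGroup M] [Module R M]
    [Module.Finite R M] : IsAdicComplete (IsLocalRing.maximalIdeal R) M := by
  have : IsPrecomplete (IsLocalRing.maximalIdeal R) M := by
    rw [← AdicCompletion.of_surjective_iff]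
    intro y
    obtain ⟨t, rfl⟩ :=
      AdicCompletion.ofTensorProduct_surjective_of_finite (IsLocalRing.maximalIdeal R) M y
    induction t with
    | zero => exact ⟨0, by simp⟩
    | add s t hs ht =>
      obtain ⟨u, hu⟩ := hs
      obtain ⟨v, hv⟩ := ht
      exact ⟨u + v, by simp [hu, hv]⟩
    | tmul r m =>
      obtain ⟨a, rfl⟩ := AdicCompletion.of_surjective (IsLocalRing.maximalIdeal R) R r
      refine ⟨a • m, ?_⟩
      rw [AdicCompletion.ofTensorProduct_tmul]
      ext n
      rfl
  constructor

open IsLocalRing Polynomial in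
lemma HenselianLocalRing.exists_pow_eq {R : Type*} [CommRing R] [HenselianLocalRing R] {n : ℕ}
    (hn : (n : ResidueField R) ≠ 0) {x : R} {y : ResidueField R} (hy : y ≠ 0)
    (h : y ^ n = residue R x) : ∃ z : R, z ^ n = x ∧ residue R z = y := by
  have hn0 : n ≠ 0 := by rintro rfl; simp at hn
  obtain ⟨z, hz, hzy⟩ := ((HenselianLocalRing.TFAE R).out 0 1 rfl rfl).mp ‹_› (X ^ n - C x)
    (monic_X_pow_sub_C x hn0) y (by simp [h])
    (by simp [derivative_X_pow, hn, hy])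
  exact ⟨z, by simpa [sub_eq_zero] using hz, hzy⟩

open IsLocalRing Polynomial in
lemma IsLocalRing.eq_of_pow_eq_one_of_residue_eq {R : Type*} [CommRing R] [IsLocalRing R] {n : ℕ}
    (hn : (n : ResidueField R) ≠ 0) {x y : R} (hx : x ^ n = 1) (hy : y ^ n = 1)
    (h : residue R x = residue R y) : x = y := by
  have hn0 : n ≠ 0 := by rintro rfl; simp at hn
  refine eq_of_eval_eq_zero_of_not_isUnit_sub (f := X ^ n - 1) (by simp [hx]) (by simp [hy]) ?_ ?_
  · rw [← residue_ne_zero_iff_isUnit, map_sub, h, sub_self]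
    simp
  · have hx0 : residue R x ≠ 0 := (residue_ne_zero_iff_isUnit x).mpr (.of_pow_eq_one hx hn0)
    rw [← residue_ne_zero_iff_isUnit]
    simp [derivative_X_pow, hn, hx0]

lemma FiniteField.exists_pow_eq_of_norm_eq_one {K L : Type*} [Field K] [Field L] [Algebra K L]
    [Finite L] {n : ℕ} (hn : n ∣ Nat.card K - 1) {x : L} (hx : Algebra.norm K x = 1) :
    ∃ y : L, y ^ n = x := by
  have hfinK : Finite K := .of_injective _ (algebraMap K L).injective
  have hpow := FiniteField.algebraMap_norm_eq_pow (K := K) (K' := L) (x := x)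
  rw [hx, map_one] at hpow
  have hx0 : x ≠ 0 := by rintro rfl; simp [Algebra.norm_zero] at hx
  obtain ⟨g, hg⟩ := IsCyclic.exists_generator (α := Lˣ)
  obtain ⟨s, hs⟩ := (mem_powers_iff_mem_zpowers (x := g)).mpr (hg (Units.mk0 x hx0))
  have hdvd : Nat.card K - 1 ∣ Nat.card L - 1 := by
    rw [Module.natCard_eq_pow_finrank (K := K) (V := L)]
    simpa using Nat.sub_one_dvd_pow_sub_one _ _
  obtain ⟨e, he⟩ := hdvd
  have hK : 0 < Nat.card K - 1 := Nat.sub_pos_of_lt Finite.one_lt_card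
  have hL : 0 < Nat.card L - 1 := Nat.sub_pos_of_lt Finite.one_lt_card
  have he0 : 0 < e := by rw [he] at hL; exact Nat.pos_of_mul_pos_left hL
  rw [he, Nat.mul_div_cancel_left _ hK] at hpow
  have hgs : g ^ (s * e) = 1 := by
    ext
    have : ((g ^ s : Lˣ) : L) = x := congrArg Units.val hs
    rw [pow_mul, Units.val_pow_eq_pow_val, this, ← hpow, Units.val_one]
  have hdvd : (Nat.card K - 1) * e ∣ s * e := by
    rw [← he, ← Nat.card_units, ← orderOf_eq_card_of_forall_mem_zpowers hg]
    exact orderOf_dvd_of_pow_eq_one hgs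
  obtain ⟨t, rfl⟩ := hn.trans (Nat.dvd_of_mul_dvd_mul_right he0 hdvd)
  refine ⟨(g ^ t : Lˣ), ?_⟩
  rw [← Units.val_pow_eq_pow_val, ← pow_mul, mul_comm t n]
  exact congrArg Units.val hs

open IsLocalRing in
lemma norm_residue_eq_one {A B F Y : Type*} [CommRing A] [IsDomain A] [IsIntegrallyClosed A]
    [IsLocalRing A] [CommRing B] [IsLocalRing B] [Field F] [Field Y] [Algebra A B] [Algebra A F]
    [Algebra A Y] [Algebra B Y] [Algebra F Y] [IsScalarTower A B Y] [IsScalarTower A F Y]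
    [IsFractionRing A F] [IsIntegralClosure B A Y] [IsLocalHom (algebraMap A B)]
    [FiniteDimensional F Y] [IsGalois F Y] [Finite (ResidueField B)]
    (hinj : ∀ σ : B ≃ₐ[A] B, (∀ x, residue B (σ x) = residue B x) → σ = 1)
    (hrank : Module.finrank (ResidueField A) (ResidueField B) = Module.finrank F Y)
    {c : B} (hc : Algebra.norm F (algebraMap B Y c) = 1) :
    Algebra.norm (ResidueField A) (residue B c) = 1 := by
  classical
  have hfinA : Finite (ResidueField A) :=
    .of_injective _ (algebraMap (ResidueField A) (ResidueField B)).injective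
  let φ : Gal(Y/F) → Gal(ResidueField B/ResidueField A) := fun σ ↦
    ResidueField.mapAlgEquiv' (galRestrict A F Y B σ)
  have hφ : Function.Injective φ := by
    intro σ τ h
    have h1 : galRestrict A F Y B (σ * τ⁻¹) = 1 := hinj _ fun x ↦ by
      obtain ⟨y, rfl⟩ := (galRestrict A F Y B τ).surjective x
      have h2 : galRestrict A F Y B (σ * τ⁻¹) (galRestrict A F Y B τ y) =
          galRestrict A F Y B σ y := by
        rw [← AlgEquiv.mul_apply, ← map_mul, inv_mul_cancel_right]
      rw [h2]
      exact DFunLike.congr_fun h (residue B y)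
    rwa [map_eq_one_iff _ (MulEquiv.injective _), mul_inv_eq_one] at h1
  have hbij : Function.Bijective φ := (Fintype.bijective_iff_injective_and_card φ).mpr
    ⟨hφ, by rw [← Nat.card_eq_fintype_card, ← Nat.card_eq_fintype_card,
      IsGalois.card_aut_eq_finrank, IsGalois.card_aut_eq_finrank, hrank]⟩
  apply (algebraMap (ResidueField A) (ResidueField B)).injective
  have hprod : ∏ σ : Gal(Y/F), galRestrict A F Y B σ c = 1 := by
    apply IsIntegralClosure.algebraMap_injective B A Y
    rw [map_prod, map_one, ← map_one (algebraMap F Y), ← hc, Algebra.norm_eq_prod_automorphisms]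
    exact Finset.prod_congr rfl fun σ _ ↦ algebraMap_galRestrict_apply A σ c
  rw [Algebra.norm_eq_prod_automorphisms, map_one, ← map_one (residue B), ← hprod, map_prod]
  exact (Function.Bijective.prod_comp hbij fun τ ↦ τ (residue B c)).symm

lemma FiniteField.natCast_card_sub_one_ne_zero (K : Type*) [Field K] [Finite K] :
    ((Nat.card K - 1 : ℕ) : K) ≠ 0 := by
  have := Fintype.ofFinite K
  rw [Nat.cast_pred Nat.card_pos, Nat.card_eq_fintype_card, FiniteField.cast_card_eq_zero]
  simp

open IsLocalRing in
lemma IsPrimitiveRoot.dvd_card_residueField_sub_one {A F : Type*} [CommRing A] [IsDomain A]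
    [IsIntegrallyClosed A] [IsLocalRing A] [Finite (ResidueField A)] [Field F] [Algebra A F]
    [IsFractionRing A F] {n : ℕ} (hn : n.Prime) (hnk : (n : ResidueField A) ≠ 0) {ζ : F}
    (hζ : IsPrimitiveRoot ζ n) : n ∣ Nat.card (ResidueField A) - 1 := by
  have := Fintype.ofFinite (ResidueField A)
  have := Fact.mk hn
  obtain ⟨a, rfl⟩ := IsIntegrallyClosed.isIntegral_iff.mp
    (IsIntegral.of_pow hn.pos (x := ζ) (hζ.pow_eq_one ▸ isIntegral_one) : IsIntegral A ζ)
  have ha := hζ.of_map_of_injective (IsFractionRing.injective A F)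
  have hra : residue A a ^ n = 1 := by rw [← map_pow, ha.pow_eq_one, map_one]
  rw [← orderOf_eq_prime hra fun h ↦ ha.ne_one hn.one_lt
    (eq_of_pow_eq_one_of_residue_eq hnk ha.pow_eq_one (one_pow n) (by rw [h, map_one])),
    Nat.card_eq_fintype_card]
  refine orderOf_dvd_of_pow_eq_one (FiniteField.pow_card_sub_one_eq_one _ fun h ↦ ?_)
  simp [h, hn.ne_zero] at hra

open IsLocalRing in
lemma HenselianLocalRing.exists_pow_card_sub_one_eq_one (R : Type*) [CommRing R]
    [HenselianLocalRing R] [Finite (ResidueField R)] :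
    ∃ ω : R, IsPrimitiveRoot ω (Nat.card (ResidueField R) - 1) ∧
      ∀ y : ResidueField R, y ≠ 0 → ∃ s : ℕ, residue R ω ^ s = y := by
  obtain ⟨g, hg⟩ := IsCyclic.exists_generator (α := (ResidueField R)ˣ)
  have hcard : orderOf (g : ResidueField R) = Nat.card (ResidueField R) - 1 := by
    rw [orderOf_units, orderOf_eq_card_of_forall_mem_zpowers hg, Nat.card_units]
  obtain ⟨ω, hω, hωg⟩ := exists_pow_eq (FiniteField.natCast_card_sub_one_ne_zero _) (x := 1) g.ne_zero
    (by rw [← hcard, pow_orderOf_eq_one, map_one])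
  refine ⟨ω, ⟨hω, fun m hm ↦ ?_⟩, fun y hy ↦ ?_⟩
  · rw [← hcard, ← hωg]
    exact orderOf_dvd_of_pow_eq_one (by rw [← map_pow, hm, map_one])
  · obtain ⟨s, hs⟩ := (mem_powers_iff_mem_zpowers (x := g)).mpr (hg (Units.mk0 y hy))
    exact ⟨s, by rw [hωg]; exact congrArg Units.val hs⟩

lemma Algebra.adjoin_singleton_eq_top_of_finrank_prime {F Y : Type*} [Field F] [Field Y]
    [Algebra F Y] (h : (Module.finrank F Y).Prime) {x : Y} (hx : x ∉ Set.range (algebraMap F Y)) :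
    Algebra.adjoin F {x} = ⊤ := by
  have := Module.finite_of_finrank_pos h.pos
  have := Subalgebra.isSimpleOrder_of_finrank_prime F Y h
  refine (eq_bot_or_eq_top _).resolve_left fun hbot ↦ hx ?_
  exact Algebra.mem_bot.mp (hbot ▸ Algebra.self_mem_adjoin_singleton F x)

open IsLocalRing in
lemma residueField_card_le_of_mem_range {A B F Y : Type*} [CommRing A] [IsDomain A]
    [IsIntegrallyClosed A] [IsLocalRing A] [CommRing B] [IsLocalRing B] [Field F] [Field Y]
    [Algebra A B] [Algebra A F] [Algebra A Y] [Algebra B Y] [Algebra F Y] [IsScalarTower A B Y]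
    [IsScalarTower A F Y] [IsFractionRing A F] [IsIntegralClosure B A Y]
    [IsLocalHom (algebraMap A B)] [Finite (ResidueField A)] {ω : B}
    (hω : ∀ y : ResidueField B, y ≠ 0 → ∃ s : ℕ, residue B ω ^ s = y)
    (hmem : algebraMap B Y ω ∈ Set.range (algebraMap F Y)) :
    Nat.card (ResidueField B) ≤ Nat.card (ResidueField A) := by
  obtain ⟨f, hf⟩ := hmem
  have hint : IsIntegral A f := by
    rw [← isIntegral_algebraMap_iff (algebraMap F Y).injective, hf]
    exact (IsIntegralClosure.isIntegral A Y ω).algebraMap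
  obtain ⟨a, rfl⟩ := IsIntegrallyClosed.isIntegral_iff.mp hint
  rw [← IsScalarTower.algebraMap_apply, IsScalarTower.algebraMap_apply A B Y] at hf
  obtain rfl := IsIntegralClosure.algebraMap_injective B A Y hf
  refine Nat.card_le_card_of_surjective (algebraMap (ResidueField A) (ResidueField B)) fun y ↦ ?_
  rcases eq_or_ne y 0 with rfl | hy
  · exact ⟨0, map_zero _⟩
  · obtain ⟨s, rfl⟩ := hω y hy
    exact ⟨residue A a ^ s, map_pow _ _ _⟩

open IsLocalRing in
theorem exists_pow_eq_of_norm_eq_one_of_unramified {A B F Y : Type*} [CommRing A] [IsDomain A]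
    [IsNoetherianRing A] [IsLocalRing A] [IsAdicComplete (maximalIdeal A) A]
    [IsIntegrallyClosed A] [Finite (ResidueField A)] [CommRing B] [IsLocalRing B] [Field F]
    [Field Y] [Algebra A B] [Algebra A F] [Algebra A Y] [Algebra B Y] [Algebra F Y]
    [IsScalarTower A B Y] [IsScalarTower A F Y] [IsFractionRing A F] [IsIntegralClosure B A Y]
    {ℓ : ℕ} (hℓ : ℓ.Prime) (hℓk : (ℓ : ResidueField A) ≠ 0) {ζ : F} (hζ : IsPrimitiveRoot ζ ℓ)
    (hdeg : Module.finrank F Y = ℓ)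
    (hunram : maximalIdeal B = (maximalIdeal A).map (algebraMap A B))
    (hres : Nat.card (ResidueField B) = Nat.card (ResidueField A) ^ ℓ) {c : B}
    (hc : Algebra.norm F (algebraMap B Y c) = 1) : ∃ d : B, d ^ ℓ = c := by
  have hfin : FiniteDimensional F Y := Module.finite_of_finrank_pos (hdeg ▸ hℓ.pos)
  have hsep : Algebra.IsSeparable F Y := by
    by_contra h
    have htr := LinearMap.congr_fun (Algebra.trace_eq_zero_of_not_isSeparable h)
      (algebraMap F Y 1)
    rw [Algebra.trace_algebraMap, hdeg, nsmul_one, LinearMap.zero_apply,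
      ← map_natCast (algebraMap A F), IsFractionRing.to_map_eq_zero_iff] at htr
    exact hℓk (by rw [← map_natCast (residue A), htr, map_zero])
  have hfinB : Module.Finite A B := IsIntegralClosure.finite A F Y B
  have hlocal : IsLocalHom (algebraMap A B) :=
    ((local_hom_TFAE (algebraMap A B)).out 0 2 rfl rfl).mpr hunram.ge
  have hcomplete : IsAdicComplete (maximalIdeal B) B := by
    rw [hunram, IsAdicComplete.map_algebraMap_iff]
    exact .of_moduleFinite B
  have hhens : HenselianLocalRing B :=
    { is_henselian f hf a₀ h₁ h₂ := HenselianRing.is_henselian f hf a₀ h₁ (h₂.map _) }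
  have hfink : Finite (ResidueField B) :=
    Nat.finite_of_card_ne_zero (hres ▸ pow_ne_zero _ Nat.card_pos.ne')
  have hrank : Module.finrank (ResidueField A) (ResidueField B) = ℓ :=
    Nat.pow_right_injective (Finite.one_lt_card (α := ResidueField A))
      (Module.natCard_eq_pow_finrank.symm.trans hres)
  obtain ⟨ω, hω, hgen⟩ := HenselianLocalRing.exists_pow_card_sub_one_eq_one B
  have hadj : Algebra.adjoin F {algebraMap B Y ω} = ⊤ :=
    Algebra.adjoin_singleton_eq_top_of_finrank_prime (hdeg ▸ hℓ) fun hmem ↦ by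
      have hle := residueField_card_le_of_mem_range (A := A) hgen hmem
      rw [hres] at hle
      exact (lt_self_pow₀ Finite.one_lt_card hℓ.one_lt).not_ge hle
  have hωY := hω.map_of_injective (IsIntegralClosure.algebraMap_injective B A Y)
  have hcard : Nat.card (ResidueField B) - 1 ≠ 0 := (Nat.sub_pos_of_lt Finite.one_lt_card).ne'
  have hcyc : IsCyclotomicExtension {Nat.card (ResidueField B) - 1} F Y := by
    refine (IsCyclotomicExtension.iff_adjoin_eq_top _ _ _).mpr
      ⟨fun n hn _ ↦ ⟨_, hn ▸ hωY⟩, top_unique (hadj ▸ Algebra.adjoin_mono ?_)⟩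
    exact Set.singleton_subset_iff.mpr ⟨_, rfl, hcard, hωY.pow_eq_one⟩
  have hgal : IsGalois F Y := IsCyclotomicExtension.isGalois {Nat.card (ResidueField B) - 1} F Y
  have hinj (σ : B ≃ₐ[A] B) (h : ∀ x, residue B (σ x) = residue B x) : σ = 1 := by
    have hσω : σ ω = ω := eq_of_pow_eq_one_of_residue_eq
      (FiniteField.natCast_card_sub_one_ne_zero _)
      (by rw [← map_pow, hω.pow_eq_one, map_one]) hω.pow_eq_one (h ω)
    obtain ⟨τ, rfl⟩ := (galRestrict A F Y B).surjective σ
    rw [map_eq_one_iff _ (MulEquiv.injective _)]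
    have hτ : (τ : Y →ₐ[F] Y) = AlgHom.id F Y := AlgHom.ext_of_adjoin_eq_top hadj (by
      rintro _ rfl
      simpa [hσω] using (algebraMap_galRestrict_apply A τ ω).symm)
    exact AlgEquiv.ext fun y ↦ DFunLike.congr_fun hτ y
  have hnorm := norm_residue_eq_one hinj (hrank.trans hdeg.symm) hc
  obtain ⟨y, hy⟩ := FiniteField.exists_pow_eq_of_norm_eq_one
    (hζ.dvd_card_residueField_sub_one hℓ hℓk) hnorm
  have hy0 : y ≠ 0 := by
    rintro rfl
    rw [← hy, zero_pow hℓ.ne_zero, Algebra.norm_zero] at hnorm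
    exact zero_ne_one hnorm
  have hℓB : (ℓ : ResidueField B) ≠ 0 := by
    rw [← map_natCast (algebraMap (ResidueField A) (ResidueField B))]
    exact (map_ne_zero _).mpr hℓk
  exact (HenselianLocalRing.exists_pow_eq hℓB hy0 hy).imp fun _ h ↦ h.1

/-- Let `A` be a complete regular local domain (Noetherian local
domain, complete for the maximal-adic topology, whose maximal ideal is generated by
Krull-dimension-of-`A` many elements) with finite residue field `k` and fraction field
`F`, let `ℓ` be a prime invertible in `k`, and assume `F` contains a primitive `ℓ`-th
root of unity.  If `Y/F` is a degree-`ℓ` field extension unramified over `A` (the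
integral closure `B` of `A` in `Y` is local, its maximal ideal is generated by that of
`A`, and its residue field has degree `ℓ` over `k`, expressed by `|k_B| = |k|^ℓ`), then
every element of `Y` that is integral over `A` and has norm `1` to `F` is an `ℓ`-th
power in `Y`. -/
theorem statement9
    (A : Type*) [CommRing A] [IsDomain A] [IsNoetherianRing A] [IsLocalRing A]
    [IsAdicComplete (IsLocalRing.maximalIdeal A) A]
    (hreg : ∃ s : Finset A, IsLocalRing.maximalIdeal A = Ideal.span ↑s ∧
      ringKrullDim A = s.card)
    [Finite (IsLocalRing.ResidueField A)]
    (F : Type*) [Field F] [Algebra A F] [IsFractionRing A F]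
    (ℓ : ℕ) (hℓ : ℓ.Prime) (hℓk : (ℓ : IsLocalRing.ResidueField A) ≠ 0)
    (hroot : ∃ ζ : F, IsPrimitiveRoot ζ ℓ)
    (Y : Type*) [Field Y] [Algebra F Y] [Algebra A Y] [IsScalarTower A F Y]
    (hdeg : Module.finrank F Y = ℓ)
    [IsLocalRing ↥(integralClosure A Y)]
    (hunram : IsLocalRing.maximalIdeal ↥(integralClosure A Y) =
      Ideal.map (algebraMap A ↥(integralClosure A Y)) (IsLocalRing.maximalIdeal A))
    (hres : Nat.card (IsLocalRing.ResidueField ↥(integralClosure A Y)) =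
      Nat.card (IsLocalRing.ResidueField A) ^ ℓ)
    (c : Y) (hc : IsIntegral A c) (hnorm : Algebra.norm F c = 1) :
    ∃ d : Y, c = d ^ ℓ := by
  have hregA : IsRegularLocalRing A := by
    obtain ⟨s, hs, hdim⟩ := hreg
    refine .of_spanFinrank_maximalIdeal_le _ ?_
    rw [hdim, hs, Nat.cast_le]
    exact (Submodule.spanFinrank_span_le_ncard_of_finite s.finite_toSet).trans_eq
      (Set.ncard_coe_finset s)
  have hnormal : IsIntegrallyClosed A :=
    (IsRegularLocalRing.isDomain_and_dvdOfAlmostDvd _ A rfl).2.isIntegrallyClosed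
  obtain ⟨ζ, hζ⟩ := hroot
  obtain ⟨d, hd⟩ := exists_pow_eq_of_norm_eq_one_of_unramified
    (B := integralClosure A Y) (c := ⟨c, hc⟩) hℓ hℓk hζ hdeg hunram hres hnorm
  exact ⟨d, congrArg Subtype.val hd.symm⟩
end

section
/- Let A be a complete regular local domain of Krull dimension 2 with finite residue field k and fraction field F, let ℓ be a prime that is invertible in k, and assume F contains a primitive ℓ²-th root of unity. Let (π, δ) be a regular system of parameters of A (the maximal ideal of A is generated by π and δ), let u ∈ Aˣ be a unit, and let 0 ≤ i, j ≤ ℓ−1. Let Y = F(y) where y^ℓ = u·π^i·δ^j, and assume Y is a field extension of F of degree ℓ. If b ∈ Y is integral over A and N_{Y/F}(b) = 1, then b is an ℓ-th power in Yˣ. -/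
open IsLocalRing Polynomial

/-- A finite module over a complete Noetherian local ring is complete. -/
theorem isAdicComplete_of_finite (A M : Type*) [CommRing A] [IsNoetherianRing A] [IsLocalRing A]
    [IsAdicComplete (maximalIdeal A) A] [AddCommGroup M] [Module A M] [Module.Finite A M] :
    IsAdicComplete (maximalIdeal A) M := by
  have hsurj : Function.Surjective (AdicCompletion.of (maximalIdeal A) M) := by
    intro x
    obtain ⟨t, rfl⟩ := AdicCompletion.ofTensorProduct_surjective_of_finite (maximalIdeal A) M x
    induction t using TensorProduct.induction_on with
    | zero => exact ⟨0, by simp⟩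
    | tmul r m =>
      obtain ⟨a, rfl⟩ := AdicCompletion.of_surjective (maximalIdeal A) A r
      refine ⟨a • m, ?_⟩
      rw [AdicCompletion.ofTensorProduct_tmul, map_smul]
      ext n
      rfl
    | add s t hs ht =>
      obtain ⟨a, ha⟩ := hs
      obtain ⟨c, hc⟩ := ht
      exact ⟨a + c, by rw [map_add, map_add, ha, hc]⟩
  exact AdicCompletion.of_bijective_iff.mp ⟨AdicCompletion.of_injective _ _, hsurj⟩

theorem exists_isIdempotentElem_pow {M : Type*} [Monoid M] [Finite M] (x : M) :
    ∃ n : ℕ, n ≠ 0 ∧ IsIdempotentElem (x ^ n) := by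
  obtain ⟨a, c, hac, h⟩ : ∃ a c : ℕ, a < c ∧ x ^ a = x ^ c := by
    obtain ⟨a, c, hne, h⟩ := Finite.exists_ne_map_eq_of_infinite (fun n : ℕ => x ^ n)
    rcases lt_or_gt_of_ne hne with hlt | hlt
    · exact ⟨a, c, hlt, h⟩
    · exact ⟨c, a, hlt, h.symm⟩
  obtain ⟨p, rfl⟩ := Nat.exists_eq_add_of_lt hac
  have hstep : ∀ k s : ℕ, x ^ (a + s + k * (p + 1)) = x ^ (a + s) := by
    intro k
    induction k with
    | zero => simp
    | succ k ih =>
      intro s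
      rw [show a + s + (k + 1) * (p + 1) = (a + p + 1) + (s + k * (p + 1)) by ring, pow_add, ← h,
        ← pow_add, ← add_assoc, ih]
  refine ⟨(a + 1) * (p + 1), by positivity, ?_⟩
  have := hstep (a + 1) ((a + 1) * (p + 1) - a)
  have hle : a ≤ (a + 1) * (p + 1) := by nlinarith
  rwa [Nat.add_sub_cancel' hle, pow_add] at this

/-- In a domain that is Henselian along an ideal with finite quotient, every element is a unit
or nilpotent modulo that ideal. -/
theorem isUnit_or_exists_pow_mem {B : Type*} [CommRing B] [IsDomain B] (I : Ideal B)
    [HenselianRing B I] [Finite (B ⧸ I)] (x : B) : IsUnit x ∨ ∃ n : ℕ, x ^ n ∈ I := by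
  obtain ⟨n, hn, h⟩ := exists_isIdempotentElem_pow (Ideal.Quotient.mk I x)
  have hroot : (X ^ 2 - X : B[X]).eval (x ^ n) ∈ I := by
    rw [← Ideal.Quotient.eq_zero_iff_mem]
    simp only [eval_sub, eval_pow, eval_X, map_sub, map_pow]
    rw [pow_two, h.eq, sub_self]
  have hder : IsUnit (Ideal.Quotient.mk I ((derivative (X ^ 2 - X : B[X])).eval (x ^ n))) := by
    have hd : (derivative (X ^ 2 - X : B[X])).eval (x ^ n) = 2 * x ^ n - 1 := by
      norm_num
    refine IsUnit.of_mul_eq_one (Ideal.Quotient.mk I (2 * x ^ n - 1)) ?_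
    rw [hd, ← map_mul, ← map_one (Ideal.Quotient.mk I), Ideal.Quotient.eq]
    convert I.mul_mem_left 4 hroot using 1
    simp only [eval_sub, eval_pow, eval_X]
    ring
  obtain ⟨e, he, hex⟩ := HenselianRing.is_henselian (I := I) (X ^ 2 - X : B[X])
    (by monicity!) (x ^ n) hroot hder
  have he' : e * (e - 1) = 0 := by
    have : e ^ 2 - e = 0 := by simpa [IsRoot] using he
    linear_combination this
  rcases mul_eq_zero.mp he' with h0 | h1
  · right
    refine ⟨n, ?_⟩
    rw [h0, zero_sub] at hex
    exact (Ideal.neg_mem_iff I).mp hex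
  · left
    have := Ideal.mem_jacobson_bot.mp (HenselianRing.jac hex) (-1)
    rw [sub_eq_zero.mp h1] at this
    have hu : IsUnit (x ^ n) := by
      convert this using 1
      ring
    exact (isUnit_pow_iff hn).mp hu

/-- Hensel's lemma for `ℓ`-th roots along an ideal whose radical contains the maximal ideal. -/
theorem exists_pow_eq_of_residue {B : Type*} [CommRing B] [IsLocalRing B] (I : Ideal B)
    [HenselianRing B I] (hI : ∀ x ∈ maximalIdeal B, ∃ n : ℕ, x ^ n ∈ I)
    {ℓ : ℕ} (hℓ0 : ℓ ≠ 0) (hℓ : IsUnit (ℓ : B)) {b c : B} (hc : IsUnit c)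
    (h : residue B c ^ ℓ = residue B b) : ∃ d : B, d ^ ℓ = b := by
  have hmem : c ^ ℓ - b ∈ maximalIdeal B := by
    rw [← residue_eq_zero_iff, map_sub, map_pow, h, sub_self]
  obtain ⟨n, hn⟩ := hI _ hmem
  let q := Ideal.Quotient.mk I
  have hnil : IsNilpotent (aeval (q c) (X ^ ℓ - C b : B[X])) := by
    refine ⟨n, ?_⟩
    have : (aeval (q c) (X ^ ℓ - C b : B[X])) = q (c ^ ℓ - b) := by
      simp [q, Ideal.Quotient.algebraMap_eq]
    rw [this, ← map_pow]
    exact Ideal.Quotient.eq_zero_iff_mem.mpr hn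
  have hun : IsUnit (aeval (q c) (derivative (X ^ ℓ - C b : B[X]))) := by
    have : aeval (q c) (derivative (X ^ ℓ - C b : B[X])) = q (ℓ * c ^ (ℓ - 1)) := by
      simp [q, derivative_X_pow]
    rw [this]
    exact (hℓ.mul (hc.pow _)).map q
  obtain ⟨r, ⟨hr, hr0⟩, -⟩ := existsUnique_nilpotent_sub_and_aeval_eq_zero hnil hun
  obtain ⟨s, rfl⟩ := Ideal.Quotient.mk_surjective r
  have hsunit : IsUnit (q s) := by
    have hcs : IsUnit (q c) := hc.map q
    have := hr.neg.isUnit_add_left_of_commute hcs (Commute.all _ _)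
    simpa [q] using this
  obtain ⟨d, hd, -⟩ := HenselianRing.is_henselian (I := I) (X ^ ℓ - C b : B[X])
    (monic_X_pow_sub_C b hℓ0) s
    (by
      rw [← Ideal.Quotient.eq_zero_iff_mem]
      simpa [q, Ideal.Quotient.algebraMap_eq] using hr0)
    (by
      have : q (eval s (derivative (X ^ ℓ - C b : B[X]))) = q ℓ * q s ^ (ℓ - 1) := by
        simp [derivative_X_pow]
      rw [this]
      exact (hℓ.map q).mul (hsunit.pow _))
  exact ⟨d, sub_eq_zero.mp (by simpa [IsRoot] using hd)⟩

/-- In a finite cyclic group with `ℓ` endomorphisms fixing an element of order `ℓ ^ 2`, an element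
whose images multiply to `1` is an `ℓ`-th power. -/
theorem exists_pow_eq_of_prod_eq_one {E ι : Type*} [CommGroup E] [IsCyclic E] [Finite E]
    [Fintype ι] {ℓ : ℕ} (hℓ0 : ℓ ≠ 0) (hcard : Fintype.card ι = ℓ) (f : ι → E →* E) {z : E}
    (hz : orderOf z = ℓ ^ 2) (hfz : ∀ i, f i z = z) {b : E} (hb : ∏ i, f i b = 1) :
    ∃ c : E, c ^ ℓ = b := by
  obtain ⟨g, hg⟩ := IsCyclic.exists_generator (α := E)
  have hpow : ∀ x : E, ∃ n : ℕ, g ^ n = x := fun x =>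
    (mem_powers_iff_mem_zpowers (x := g)).mpr (hg x)
  choose Q hQ using fun i => hpow (f i g)
  have hf : ∀ i x, f i x = x ^ Q i := by
    intro i x
    obtain ⟨n, rfl⟩ := hpow x
    rw [map_pow, ← hQ, ← pow_mul, ← pow_mul, mul_comm]
  have hQ1 : ∀ i, Q i ≡ 1 [MOD ℓ ^ 2] := by
    intro i
    rw [← hz, ← pow_eq_pow_iff_modEq, ← hf, hfz, pow_one]
  have hsum : ∑ i, Q i ≡ ℓ [MOD ℓ ^ 2] := by
    have : ∑ i, Q i ≡ ∑ _i : ι, 1 [MOD ℓ ^ 2] := Nat.ModEq.sum fun i _ => hQ1 i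
    simpa [hcard] using this
  obtain ⟨a, rfl⟩ := hpow b
  have h1 : g ^ (a * ∑ i, Q i) = 1 := by
    rw [pow_mul, ← Finset.prod_pow_eq_pow_sum, ← hb]
    simp [hf]
  have hdvd : ℓ ^ 2 ∣ a * ∑ i, Q i := by
    refine dvd_trans ?_ (orderOf_dvd_of_pow_eq_one h1)
    rw [← hz]
    obtain ⟨n, rfl⟩ := hpow z
    exact orderOf_pow_dvd n
  have hdvd' : ℓ ^ 2 ∣ a * ℓ :=
    (Nat.modEq_zero_iff_dvd).mp
      (((hsum.mul_left a).symm).trans ((Nat.modEq_zero_iff_dvd).mpr hdvd))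
  obtain ⟨t, rfl⟩ : ℓ ∣ a := by
    rw [pow_two] at hdvd'
    exact Nat.dvd_of_mul_dvd_mul_right (Nat.pos_of_ne_zero hℓ0) hdvd'
  exact ⟨g ^ t, by rw [← pow_mul, mul_comm]⟩

/-- If `ℓ` is a unit, a primitive `ℓ ^ 2`-th root of unity keeps its order in the residue field. -/
theorem orderOf_residue_of_isPrimitiveRoot {B : Type*} [CommRing B] [IsDomain B] [IsLocalRing B]
    {ℓ : ℕ} (hℓ : ℓ.Prime) (hunit : IsUnit (ℓ : B)) {z : B} (hz : IsPrimitiveRoot z (ℓ ^ 2)) :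
    orderOf (residue B z) = ℓ ^ 2 := by
  have := Fact.mk hℓ
  refine orderOf_eq_prime_pow (n := 1) ?_ (by rw [← map_pow, hz.pow_eq_one, map_one])
  intro h
  have hω : IsPrimitiveRoot (z ^ ℓ) ℓ := hz.pow (pow_pos hℓ.pos 2) (pow_two ℓ)
  have hsum := congrArg (residue B) (hω.geom_sum_eq_zero hℓ.one_lt)
  have h' : residue B z ^ ℓ = 1 := by simpa using h
  simp only [map_sum, map_pow, h', one_pow, map_zero, Finset.sum_const, Finset.card_range,
    nsmul_eq_mul, mul_one] at hsum
  rw [← map_natCast (residue B)] at hsum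
  exact (hunit.map (residue B)).ne_zero hsum

/-- Let `B` be a domain containing a primitive `ℓ ^ 2`-th root of unity, with `ℓ` invertible, that
is Henselian along an ideal with finite quotient. If `ℓ` automorphisms of `B` fix that root of unity
and the images of `b` multiply to `1`, then `b` is an `ℓ`-th power. -/
theorem exists_pow_eq_of_prod_automorphisms_eq_one {B ι : Type*} [CommRing B] [IsDomain B]
    (I : Ideal B) [HenselianRing B I] [Finite (B ⧸ I)] {ℓ : ℕ} (hℓ : ℓ.Prime)
    (hunit : IsUnit (ℓ : B)) {z : B} (hz : IsPrimitiveRoot z (ℓ ^ 2)) [Fintype ι]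
    (hcard : Fintype.card ι = ℓ) (τ : ι → B ≃+* B) (hτ : ∀ i, τ i z = z) {b : B}
    (hb : ∏ i, τ i b = 1) : ∃ d : B, d ^ ℓ = b := by
  have hdich := isUnit_or_exists_pow_mem I
  have hlocal : IsLocalRing B := by
    refine IsLocalRing.of_isUnit_or_isUnit_one_sub_self fun x => (hdich x).imp_right ?_
    rintro ⟨n, hn⟩
    have h1 : IsUnit (1 - x ^ n) := by
      have := Ideal.mem_jacobson_bot.mp (HenselianRing.jac hn) (-1)
      convert this using 1
      ring
    exact isUnit_of_dvd_unit (by simpa using sub_dvd_pow_sub_pow 1 x n) h1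
  have hI : ∀ x ∈ maximalIdeal B, ∃ n : ℕ, x ^ n ∈ I := fun x hx =>
    (hdich x).resolve_left ((mem_maximalIdeal x).mp hx)
  have hle : I ≤ maximalIdeal B :=
    HenselianRing.jac.trans (IsLocalRing.jacobson_eq_maximalIdeal ⊥ bot_ne_top).le
  have : Finite (ResidueField B) :=
    Finite.of_surjective (Ideal.Quotient.factor hle) (Ideal.Quotient.factor_surjective hle)
  have hbu : IsUnit b := by
    obtain ⟨i⟩ : Nonempty ι := Fintype.card_pos_iff.mp (hcard ▸ hℓ.pos)
    have hi : IsUnit (τ i b) :=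
      isUnit_of_dvd_one (hb ▸ Finset.dvd_prod_of_mem (fun i => τ i b) (Finset.mem_univ i))
    exact (MulEquiv.isUnit_map (τ i)).mp hi
  have hzu : IsUnit z := hz.isUnit (pow_pos hℓ.pos 2).ne'
  obtain ⟨c, hc⟩ := exists_pow_eq_of_prod_eq_one (E := (ResidueField B)ˣ) hℓ.ne_zero hcard
    (fun i => Units.map (ResidueField.mapEquiv (τ i) : ResidueField B →* ResidueField B))
    (z := Units.map (residue B : B →* ResidueField B) hzu.unit)
    (b := Units.map (residue B : B →* ResidueField B) hbu.unit)
    (by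
      rw [← orderOf_units]
      exact orderOf_residue_of_isPrimitiveRoot hℓ hunit hz)
    (by
      intro i
      ext
      simp [ResidueField.mapEquiv, hτ])
    (by
      ext
      have := congrArg (residue B) hb
      simpa [ResidueField.mapEquiv, Units.coe_prod] using this)
  obtain ⟨c', hc'⟩ := residue_surjective (c : ResidueField B)
  refine exists_pow_eq_of_residue I hI hℓ.ne_zero hunit (c := c') (b := b) ?_ ?_
  · refine (isUnit_map_iff (residue B) c').mp ?_
    rw [hc']
    exact c.isUnit
  · rw [hc', ← Units.val_pow_eq_pow_val, hc]
    simp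

/-- A Kummer extension of degree `n` is Galois. -/
theorem isGalois_of_pow_mem_range {F Y : Type*} [Field F] [Field Y] [Algebra F Y]
    {n : ℕ} (hn : n ≠ 0) {ζ : F} (hζ : IsPrimitiveRoot ζ n) (hdeg : Module.finrank F Y = n)
    {y : Y} (hy : y ^ n ∈ Set.range (algebraMap F Y))
    (hgen : IntermediateField.adjoin F {y} = ⊤) : IsGalois F Y := by
  subst hdeg
  have : FiniteDimensional F Y := Module.finite_of_finrank_pos (Nat.pos_of_ne_zero hn)
  have hroots : (primitiveRoots (Module.finrank F Y) F).Nonempty :=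
    ⟨ζ, (mem_primitiveRoots (Nat.pos_of_ne_zero hn)).mpr hζ⟩
  have htfae := (isCyclic_tfae F Y hroots).out 0 2
  exact (htfae.mpr ⟨y, hy, hgen⟩).1

/-- Over a complete Noetherian local domain with finite residue field, an integral element of norm
`1` in a Galois extension of prime degree `ℓ` is an `ℓ`-th power, provided that `ℓ` is invertible
and that there is a primitive `ℓ ^ 2`-th root of unity. -/
theorem exists_pow_eq_of_norm_eq_one {A F Y : Type*} [CommRing A] [IsNoetherianRing A]
    [IsLocalRing A] [IsAdicComplete (maximalIdeal A) A] [Finite (ResidueField A)]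
    [Field F] [Algebra A F] [Field Y] [Algebra F Y] [Algebra A Y] [IsScalarTower A F Y]
    [FiniteDimensional F Y] [IsGalois F Y] {ℓ : ℕ} (hℓ : ℓ.Prime) (hunit : IsUnit (ℓ : A))
    (hdeg : Module.finrank F Y = ℓ) {ζ : F} (hζ : IsPrimitiveRoot ζ (ℓ ^ 2)) {b : Y}
    (hb : IsIntegral A b) (hnorm : Algebra.norm F b = 1) : ∃ d : Y, d ^ ℓ = b := by
  let s : Set Y := insert (algebraMap F Y ζ) (Set.range fun g : Gal(Y/F) => g b)
  let B := Algebra.adjoin A s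
  have hsfin : s.Finite := (Set.finite_range _).insert _
  have hζY : IsPrimitiveRoot (algebraMap F Y ζ) (ℓ ^ 2) :=
    hζ.map_of_injective (algebraMap F Y).injective
  have hsint : ∀ x ∈ s, IsIntegral A x := by
    rintro x (rfl | ⟨g, rfl⟩)
    · exact IsIntegral.of_pow (pow_pos hℓ.pos 2) (by rw [hζY.pow_eq_one]; exact isIntegral_one)
    · exact hb.map (g.toAlgHom.restrictScalars A)
  have hfin : Module.Finite A B := Module.Finite.iff_fg.mpr (fg_adjoin_of_finite hsfin hsint)
  have hstable : ∀ (g : Gal(Y/F)), ∀ x ∈ B, g x ∈ B := by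
    intro g x hx
    have hmap : B.map (g.toAlgHom.restrictScalars A) ≤ B := by
      rw [AlgHom.map_adjoin, Algebra.adjoin_le_iff]
      rintro _ ⟨w, rfl | ⟨h, rfl⟩, rfl⟩
      · refine Algebra.subset_adjoin (Or.inl ?_)
        simp
      · exact Algebra.subset_adjoin (Or.inr ⟨g * h, rfl⟩)
    exact hmap ⟨x, hx, rfl⟩
  let τ : Gal(Y/F) → B ≃+* B := fun g =>
    { toFun := fun x => ⟨g x, hstable g x x.2⟩
      invFun := fun x => ⟨g.symm x, hstable g.symm x x.2⟩
      left_inv := fun x => by simp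
      right_inv := fun x => by simp
      map_mul' := fun x w => by ext; simp
      map_add' := fun x w => by ext; simp }
  let I := (maximalIdeal A).map (algebraMap A B)
  have hcompl : IsAdicComplete I B :=
    (IsAdicComplete.map_algebraMap_iff (maximalIdeal A) B).mpr (isAdicComplete_of_finite A B)
  have hquot : Finite (B ⧸ I) := by
    have : Module.Finite (A ⧸ maximalIdeal A) (B ⧸ I) :=
      Module.Finite.of_restrictScalars_finite A _ _
    have : Finite (A ⧸ maximalIdeal A) := ‹Finite (ResidueField A)›
    exact Module.finite_of_finite (A ⧸ maximalIdeal A)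
  let z : B := ⟨algebraMap F Y ζ, Algebra.subset_adjoin (Or.inl rfl)⟩
  let b' : B := ⟨b, Algebra.subset_adjoin (Or.inr ⟨1, rfl⟩)⟩
  have hz : IsPrimitiveRoot z (ℓ ^ 2) :=
    IsPrimitiveRoot.of_map_of_injective (f := B.val) hζY Subtype.val_injective
  obtain ⟨d, hd⟩ := exists_pow_eq_of_prod_automorphisms_eq_one I hℓ
    (by simpa using hunit.map (algebraMap A B)) hz
    (by rw [← Nat.card_eq_fintype_card, IsGalois.card_aut_eq_finrank, hdeg]) τ
    (fun g => Subtype.ext (g.commutes ζ)) (b := b')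
    (by
      have h := Algebra.norm_eq_prod_automorphisms F b
      rw [hnorm, map_one] at h
      ext
      simp [τ, b', h])
  exact ⟨d, congrArg Subtype.val hd⟩


/-- Let `A` be a complete regular local domain of Krull dimension 2
with finite residue field `k` and fraction field `F`, `ℓ` a prime invertible in `k`,
and assume `F` contains a primitive `ℓ²`-th root of unity.  Let `(π, δ)` be a regular
system of parameters of `A`, `u ∈ Aˣ`, `0 ≤ i, j ≤ ℓ - 1`, and let `Y = F(y)` be a
degree-`ℓ` field extension of `F` with `y^ℓ = u·π^i·δ^j`.  Then any `b ∈ Y` that is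
integral over `A` with `N_{Y/F}(b) = 1` is an `ℓ`-th power in `Yˣ`. -/
theorem statement10
    (A : Type*) [CommRing A] [IsDomain A] [IsNoetherianRing A] [IsLocalRing A]
    [IsAdicComplete (IsLocalRing.maximalIdeal A) A]
    (hdim : ringKrullDim A = 2)
    [Finite (IsLocalRing.ResidueField A)]
    (F : Type*) [Field F] [Algebra A F] [IsFractionRing A F]
    (ℓ : ℕ) (hℓ : ℓ.Prime) (hℓk : (ℓ : IsLocalRing.ResidueField A) ≠ 0)
    (hroot : ∃ ζ : F, IsPrimitiveRoot ζ (ℓ ^ 2))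
    (π δ : A) (hparam : IsLocalRing.maximalIdeal A = Ideal.span {π, δ})
    (u : A) (hu : IsUnit u)
    (i j : ℕ) (hi : i ≤ ℓ - 1) (hj : j ≤ ℓ - 1)
    (Y : Type*) [Field Y] [Algebra F Y] [Algebra A Y] [IsScalarTower A F Y]
    (y : Y) (hy : y ^ ℓ = algebraMap F Y (algebraMap A F (u * π ^ i * δ ^ j)))
    (hgen : IntermediateField.adjoin F {y} = ⊤)
    (hdeg : Module.finrank F Y = ℓ)
    (b : Y) (hb : IsIntegral A b) (hnorm : Algebra.norm F b = 1) :
    ∃ d : Yˣ, b = (d : Y) ^ ℓ := by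
  obtain ⟨ζ, hζ⟩ := hroot
  have hunit : IsUnit (ℓ : A) := by
    refine (isUnit_map_iff (IsLocalRing.residue A) (ℓ : A)).mp ?_
    rw [map_natCast]
    exact isUnit_iff_ne_zero.mpr hℓk
  have : FiniteDimensional F Y := Module.finite_of_finrank_pos (hdeg ▸ hℓ.pos)
  have : IsGalois F Y := isGalois_of_pow_mem_range hℓ.ne_zero
    (hζ.pow (pow_pos hℓ.pos 2) (pow_two ℓ)) hdeg ⟨_, hy.symm⟩ hgen
  obtain ⟨d, hd⟩ := exists_pow_eq_of_norm_eq_one hℓ hunit hdeg hζ hb hnorm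
  have hd0 : d ≠ 0 := by
    rintro rfl
    rw [zero_pow hℓ.ne_zero] at hd
    rw [← hd, Algebra.norm_zero] at hnorm
    exact zero_ne_one hnorm
  exact ⟨Units.mk0 d hd0, hd.symm⟩
end
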